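/- Fix n ≥ 1 and consider the singlet projectors H_{ij} on n+1 qubits with sites {0,1,…,n}. Then the following sum-of-squares matrix identity holds: (√((n+1)/2)·I − √(2/(n+1))·Σ_{i=1}^n H_{0i})² + (1/(n+1))·Σ_{1 ≤ j < k ≤ n} H_{jk} = ((n+1)/2)·I − Σ_{i=1}^n H_{0i}. (Note each H_{jk} is idempotent, so H_{jk} = H_{jk}².) In particular ((n+1)/2)·I − Σ_{i=1}^n H_{0i} is positive semidefinite. -/

import Mathlib

open Matrix Finset
open scoped ComplexOrder

noncomputable section

/-- The SWAP matrix on qubits indexed by `V`, exchanging tensor factors `i` and `j`. -/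
def swapMat {V : Type*} [Fintype V] [DecidableEq V] (i j : V) :
    Matrix (V → Fin 2) (V → Fin 2) ℂ :=
  Matrix.of fun f g => if f ∘ (Equiv.swap i j) = g then 1 else 0

/-- The singlet projector `H_{ij} = (I - P_{ij})/2`. -/
def singletProj {V : Type*} [Fintype V] [DecidableEq V] (i j : V) :
    Matrix (V → Fin 2) (V → Fin 2) ℂ :=
  (2 : ℂ)⁻¹ • (1 - swapMat i j)

lemma sum_threeCycles_eq {V α : Type*} [DecidableEq V] [CommRing α] {i j k : V}
    (hij : i ≠ j) (hik : i ≠ k) (hjk : j ≠ k) (F : (V → Fin 2) → α) (f : V → Fin 2) :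
    F ((f ∘ Equiv.swap i j) ∘ Equiv.swap i k) + F ((f ∘ Equiv.swap i k) ∘ Equiv.swap i j) =
      F (f ∘ Equiv.swap i j) + F (f ∘ Equiv.swap i k) + F (f ∘ Equiv.swap j k) - F f := by
  have h : f i = f j ∨ f i = f k ∨ f j = f k := by omega
  rcases h with h | h | h
  · have h1 : f ∘ Equiv.swap i j = f := by
      funext x; simp only [Function.comp, Equiv.swap_apply_def]; grind
    have h2 : (f ∘ Equiv.swap i k) ∘ Equiv.swap i j = f ∘ Equiv.swap j k := by
      funext x; simp only [Function.comp, Equiv.swap_apply_def]; grind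
    rw [h2, h1]; ring
  · have h1 : f ∘ Equiv.swap i k = f := by
      funext x; simp only [Function.comp, Equiv.swap_apply_def]; grind
    have h2 : (f ∘ Equiv.swap i j) ∘ Equiv.swap i k = f ∘ Equiv.swap j k := by
      funext x; simp only [Function.comp, Equiv.swap_apply_def]; grind
    rw [h2, h1]; ring
  · have h1 : f ∘ Equiv.swap j k = f := by
      funext x; simp only [Function.comp, Equiv.swap_apply_def]; grind
    have h2 : (f ∘ Equiv.swap i j) ∘ Equiv.swap i k = f ∘ Equiv.swap i j := by
      funext x; simp only [Function.comp, Equiv.swap_apply_def]; grind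
    have h3 : (f ∘ Equiv.swap i k) ∘ Equiv.swap i j = f ∘ Equiv.swap i k := by
      funext x; simp only [Function.comp, Equiv.swap_apply_def]; grind
    rw [h1, h2, h3]; ring

section SingletProjectors

variable {V : Type*} [Fintype V] [DecidableEq V]

lemma swapMat_mul_apply (i j : V) (M : Matrix (V → Fin 2) (V → Fin 2) ℂ) (f g : V → Fin 2) :
    (swapMat i j * M) f g = M (f ∘ Equiv.swap i j) g := by
  simp [Matrix.mul_apply, swapMat]

lemma swapMat_apply (i j : V) (f g : V → Fin 2) :
    swapMat i j f g = (1 : Matrix (V → Fin 2) (V → Fin 2) ℂ) (f ∘ Equiv.swap i j) g := by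
  simp [swapMat, Matrix.one_apply]

lemma swapMat_self (i : V) : swapMat i i = 1 := by
  ext f g
  rw [swapMat_apply, Equiv.swap_self, Equiv.coe_refl, Function.comp_id]

lemma swapMat_comm (i j : V) : swapMat i j = swapMat j i := by
  simp only [swapMat, Equiv.swap_comm]

lemma swapMat_mul_self (i j : V) : swapMat i j * swapMat i j = 1 := by
  ext f g
  have h : (f ∘ Equiv.swap i j) ∘ Equiv.swap i j = f := by
    funext x
    simp
  rw [swapMat_mul_apply, swapMat_apply, h]

lemma swapMat_isHermitian (i j : V) : (swapMat i j).IsHermitian := by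
  ext f g
  have h : g ∘ Equiv.swap i j = f ↔ f ∘ Equiv.swap i j = g := by
    constructor <;> rintro rfl <;> funext x <;> simp
  simp [swapMat, h, apply_ite]

lemma swapMat_anticomm {i j k : V} (hij : i ≠ j) (hik : i ≠ k) (hjk : j ≠ k) :
    swapMat i j * swapMat i k + swapMat i k * swapMat i j =
      swapMat i j + swapMat i k + swapMat j k - 1 := by
  ext f g
  simp only [Matrix.add_apply, Matrix.sub_apply, swapMat_mul_apply, swapMat_apply]
  exact sum_threeCycles_eq hij hik hjk
    (fun h => (1 : Matrix (V → Fin 2) (V → Fin 2) ℂ) h g) f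

lemma singletProj_self (i : V) : singletProj i i = 0 := by
  simp [singletProj, swapMat_self]

lemma singletProj_comm (i j : V) : singletProj i j = singletProj j i := by
  rw [singletProj, singletProj, swapMat_comm]

lemma singletProj_mul_self (i j : V) : singletProj i j * singletProj i j = singletProj i j := by
  simp only [singletProj, smul_mul_smul_comm, sub_mul, mul_sub, swapMat_mul_self, one_mul, mul_one]
  module

lemma singletProj_isHermitian (i j : V) : (singletProj i j).IsHermitian := by
  rw [Matrix.IsHermitian, singletProj, Matrix.conjTranspose_smul, Matrix.conjTranspose_sub,
    Matrix.conjTranspose_one, (swapMat_isHermitian i j).eq]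
  simp

lemma singletProj_posSemidef (i j : V) : (singletProj i j).PosSemidef := by
  have h := Matrix.posSemidef_conjTranspose_mul_self (singletProj i j)
  rwa [(singletProj_isHermitian i j).eq, singletProj_mul_self] at h

lemma singletProj_anticomm {i j k : V} (hij : i ≠ j) (hik : i ≠ k) :
    singletProj i j * singletProj i k + singletProj i k * singletProj i j =
      (2 : ℂ)⁻¹ • (singletProj i j + singletProj i k - singletProj j k)
        + if j = k then singletProj i j else 0 := by
  split_ifs with h
  · subst h
    rw [singletProj_mul_self, singletProj_self]
    module
  · have h := swapMat_anticomm hij hik h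
    rw [← eq_sub_iff_add_eq] at h
    simp only [singletProj, smul_mul_smul_comm, sub_mul, mul_sub, one_mul, mul_one, h]
    module

end SingletProjectors

lemma sum_sum_eq_two_smul_sum_Ioi {ι M : Type*} [Fintype ι] [LinearOrder ι]
    [LocallyFiniteOrderTop ι] [LocallyFiniteOrderBot ι] [AddCommGroup M] [Module ℂ M]
    (a : ι → ι → M) (hdiag : ∀ i, a i i = 0) (hcomm : ∀ i j, a i j = a j i) :
    ∑ j, ∑ k, a j k = (2 : ℂ) • ∑ j, ∑ k ∈ Ioi j, a j k := by
  have h := Finset.sum_sum_Ioi_add_eq_sum_sum_off_diag a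
  have hd : ∀ j, ∑ k ∈ {j}ᶜ, a k j = ∑ k, a j k := by
    intro j
    rw [← Finset.sum_compl_add_sum {j}]
    simp [hdiag, hcomm]
  simp only [hd] at h
  rw [← h, two_smul, ← Finset.sum_add_distrib]
  simp only [hcomm _ _, Finset.sum_add_distrib]

lemma two_smul_sq_sum_singletProj (n : ℕ) :
    (2 : ℂ) • (∑ i : Fin n, singletProj (0 : Fin (n+1)) i.succ) ^ 2 =
      ((n : ℂ) + 1) • ∑ i : Fin n, singletProj (0 : Fin (n+1)) i.succ
        - ∑ j : Fin n, ∑ k ∈ Finset.Ioi j, singletProj (j.succ : Fin (n+1)) k.succ := by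
  have hpairs := sum_sum_eq_two_smul_sum_Ioi
    (fun j k : Fin n => singletProj (j.succ : Fin (n+1)) k.succ)
    (fun j => singletProj_self _) (fun j k => singletProj_comm _ _)
  have hanti : (2 : ℂ) • (∑ i : Fin n, singletProj (0 : Fin (n+1)) i.succ) ^ 2 =
      ∑ j : Fin n, ∑ k : Fin n,
        (singletProj (0 : Fin (n+1)) j.succ * singletProj (0 : Fin (n+1)) k.succ
          + singletProj (0 : Fin (n+1)) k.succ * singletProj (0 : Fin (n+1)) j.succ) := by
    simp only [Finset.sum_add_distrib, ← Finset.mul_sum, ← Finset.sum_mul, two_smul, sq]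
  rw [hanti]
  simp only [singletProj_anticomm (Fin.succ_ne_zero _).symm (Fin.succ_ne_zero _).symm,
    Fin.succ_inj, Finset.sum_add_distrib, ← Finset.smul_sum, Finset.sum_sub_distrib, hpairs,
    Finset.sum_ite_eq, Finset.mem_univ, if_true, Finset.sum_const, Finset.card_univ,
    Fintype.card_fin, ← Nat.cast_smul_eq_nsmul ℂ]
  module

/-- Level-1 sum-of-squares identity for the uniform star graph on `n+1` qubits:
`(√((n+1)/2)·I − √(2/(n+1))·Σᵢ H_{0i})² + (1/(n+1))·Σ_{j<k} H_{jk} = ((n+1)/2)·I − Σᵢ H_{0i}`.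
In particular `((n+1)/2)·I − Σᵢ H_{0i}` is positive semidefinite. -/
theorem stmt7 (n : ℕ) (hn : 1 ≤ n) :
    (((Real.sqrt (((n : ℝ) + 1) / 2) : ℂ) • (1 : Matrix (Fin (n+1) → Fin 2) (Fin (n+1) → Fin 2) ℂ)
        - (Real.sqrt (2 / ((n : ℝ) + 1)) : ℂ) •
            ∑ i : Fin n, singletProj (0 : Fin (n+1)) i.succ) ^ 2
      + ((n : ℂ) + 1)⁻¹ • ∑ j : Fin n, ∑ k ∈ Finset.Ioi j,
          singletProj (j.succ : Fin (n+1)) k.succ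
      = (((n : ℂ) + 1) / 2) • 1 - ∑ i : Fin n, singletProj (0 : Fin (n+1)) i.succ) ∧
    ((((n : ℂ) + 1) / 2) • (1 : Matrix (Fin (n+1) → Fin 2) (Fin (n+1) → Fin 2) ℂ)
      - ∑ i : Fin n, singletProj (0 : Fin (n+1)) i.succ).PosSemidef := by
  set S := ∑ i : Fin n, singletProj (0 : Fin (n+1)) i.succ with hS
  have hn0 : (n : ℂ) + 1 ≠ 0 := by exact_mod_cast n.succ_ne_zero
  have hsq1 : (Real.sqrt (((n : ℝ) + 1) / 2) : ℂ) * Real.sqrt (((n : ℝ) + 1) / 2)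
      = ((n : ℂ) + 1) / 2 := by
    rw [← Complex.ofReal_mul, Real.mul_self_sqrt (by positivity)]
    push_cast; rfl
  have hsq2 : (Real.sqrt (2 / ((n : ℝ) + 1)) : ℂ) * Real.sqrt (2 / ((n : ℝ) + 1))
      = 2 / ((n : ℂ) + 1) := by
    rw [← Complex.ofReal_mul, Real.mul_self_sqrt (by positivity)]
    push_cast; rfl
  have hcross : (Real.sqrt (((n : ℝ) + 1) / 2) : ℂ) * Real.sqrt (2 / ((n : ℝ) + 1)) = 1 := by
    rw [← Complex.ofReal_mul, ← Real.sqrt_mul (by positivity),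
      div_mul_div_cancel₀ (by norm_num), div_self (by positivity)]
    simp
  have hSS : (2 / ((n : ℂ) + 1)) • (S * S) = S - ((n : ℂ) + 1)⁻¹ • ∑ j : Fin n,
      ∑ k ∈ Finset.Ioi j, singletProj (j.succ : Fin (n+1)) k.succ := by
    rw [div_eq_inv_mul, mul_smul, ← sq, two_smul_sq_sum_singletProj, smul_sub, smul_smul,
      inv_mul_cancel₀ hn0, one_smul]
  have hid : ((Real.sqrt (((n : ℝ) + 1) / 2) : ℂ) •
        (1 : Matrix (Fin (n+1) → Fin 2) (Fin (n+1) → Fin 2) ℂ)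
        - (Real.sqrt (2 / ((n : ℝ) + 1)) : ℂ) • S) ^ 2
      + ((n : ℂ) + 1)⁻¹ • ∑ j : Fin n, ∑ k ∈ Finset.Ioi j,
          singletProj (j.succ : Fin (n+1)) k.succ
      = (((n : ℂ) + 1) / 2) • 1 - S := by
    rw [sq]
    simp only [sub_mul, mul_sub, smul_mul_smul_comm, one_mul, mul_one, hsq1, hsq2, hSS,
      hcross, mul_comm (Real.sqrt (2 / ((n : ℝ) + 1)) : ℂ)]
    module
  refine ⟨hid, ?_⟩
  rw [← hid]
  have hSH : Sᴴ = S := by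
    rw [hS, Matrix.conjTranspose_sum]
    exact Finset.sum_congr rfl fun i _ => (singletProj_isHermitian _ _).eq
  refine Matrix.PosSemidef.add ?_ (Matrix.PosSemidef.smul ?_ ?_)
  · set A := (Real.sqrt (((n : ℝ) + 1) / 2) : ℂ) •
        (1 : Matrix (Fin (n+1) → Fin 2) (Fin (n+1) → Fin 2) ℂ)
        - (Real.sqrt (2 / ((n : ℝ) + 1)) : ℂ) • S with hA
    have hAH : Aᴴ = A := by
      simp [hA, Matrix.conjTranspose_sub, Matrix.conjTranspose_smul, hSH]
    have h := Matrix.posSemidef_conjTranspose_mul_self A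
    rwa [hAH, ← sq] at h
  · exact Matrix.posSemidef_sum _ fun j _ => Matrix.posSemidef_sum _ fun k _ =>
      singletProj_posSemidef _ _
  · rw [inv_nonneg]
    positivity

end
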